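/- arXiv:0810.4236 — 2 statements merged into one kernel-verified Lean document; each statement's English description precedes it below -/
import Mathlib

section
/- (Lemma 3.1(1)) For all indices i, j with 1 ≤ i, j ≤ k and i + j = k + 1, one has Δ_i = Δ_j, where Δ_i = f_{i+1} − f_i. -/
open Finset

/-- The set `F = { l / w j : 0 ≤ l ≤ w j - 1, 0 ≤ j ≤ n }` of rational numbers. -/
def wpF (n : ℕ) (w : Fin (n + 1) → ℕ) : Finset ℚ :=
  (Finset.univ.sigma fun j : Fin (n + 1) => Finset.range (w j)).image
    fun p => (p.2 : ℚ) / (w p.1 : ℚ)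

-- The set `S f = { j ∈ {0,…,n} : w j · f ∈ ℤ }`.
open Classical in
noncomputable def wpS (n : ℕ) (w : Fin (n + 1) → ℕ) (x : ℚ) : Finset (Fin (n + 1)) :=
  Finset.univ.filter fun j => ∃ z : ℤ, (w j : ℚ) * x = (z : ℚ)

/-- `F \ {0}` is stable under `x ↦ 1 - x`. -/
theorem one_sub_mem_wpF {n : ℕ} {w : Fin (n + 1) → ℕ} {x : ℚ} (hx : x ∈ wpF n w)
    (hx0 : x ≠ 0) : 1 - x ∈ wpF n w := by
  simp only [wpF, mem_image, mem_sigma, mem_univ, true_and, mem_range, Sigma.exists] at hx ⊢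
  obtain ⟨j, l, hl, rfl⟩ := hx
  have hl0 : l ≠ 0 := by
    rintro rfl
    simp at hx0
  have hwj : (w j : ℚ) ≠ 0 := by
    have : w j ≠ 0 := by omega
    exact_mod_cast this
  refine ⟨j, w j - l, by omega, ?_⟩
  rw [Nat.cast_sub hl.le]
  field_simp

/-- A strictly decreasing self-map of `{1, …, m}` is `i ↦ m + 1 - i`. -/
theorem add_eq_of_strictAnti_of_mem_Icc {m : ℕ} {g : ℕ → ℕ}
    (hg : ∀ i, 1 ≤ i → i ≤ m → 1 ≤ g i ∧ g i ≤ m)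
    (hanti : ∀ i, 1 ≤ i → i + 1 ≤ m → g (i + 1) < g i) {i : ℕ} (hi : 1 ≤ i) (him : i ≤ m) :
    g i + i = m + 1 := by
  have upper : ∀ i, 1 ≤ i → i ≤ m → g i + i ≤ m + 1 := by
    intro i hi
    induction i, hi using Nat.le_induction with
    | base => intro h; have := hg 1 le_rfl h; omega
    | succ i hi ih => intro h; have := ih (by omega); have := hanti i hi h; omega
  have lower : ∀ d i, 1 ≤ i → i + d = m → d + 1 ≤ g i := by
    intro d
    induction d with
    | zero => intro i hi h; have := hg i hi (by omega); omega
    | succ d ih =>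
      intro i hi h
      have := ih (i + 1) (by omega) (by omega)
      have := hanti i hi (by omega)
      omega
  have := upper i hi him
  have := lower (m - i) i hi (by omega)
  omega

theorem lemma_3_1_1 (n k : ℕ) (w : Fin (n + 1) → ℕ) (hw : ∀ j, 0 < w j)
    (f : ℕ → ℚ)
    (hmono : ∀ i j : ℕ, 1 ≤ i → i < j → j ≤ k + 1 → f i < f j)
    (hmem : ∀ i : ℕ, 1 ≤ i → i ≤ k → f i ∈ wpF n w)
    (hsurj : ∀ x ∈ wpF n w, ∃ i : ℕ, 1 ≤ i ∧ i ≤ k ∧ f i = x)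
    (hf1 : f 1 = 0) (hfk1 : f (k + 1) = 1) :
    ∀ i j : ℕ, 1 ≤ i → i ≤ k → 1 ≤ j → j ≤ k → i + j = k + 1 →
      f (i + 1) - f i = f (j + 1) - f j := by
  have hex : ∀ i, ∃ j, 1 ≤ i → i ≤ k + 1 → (1 ≤ j ∧ j ≤ k + 1) ∧ f j = 1 - f i := by
    intro i
    by_cases hi : 1 ≤ i ∧ i ≤ k + 1
    · obtain ⟨hi1, hik⟩ := hi
      rcases eq_or_lt_of_le hi1 with rfl | hi1
      · exact ⟨k + 1, fun _ _ => ⟨by omega, by rw [hf1, hfk1, sub_zero]⟩⟩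
      rcases eq_or_lt_of_le hik with rfl | hik
      · exact ⟨1, fun _ _ => ⟨by omega, by rw [hf1, hfk1, sub_self]⟩⟩
      have hpos : 0 < f i := hf1 ▸ hmono 1 i le_rfl hi1 hik.le
      obtain ⟨j, hj1, hjk, hj⟩ :=
        hsurj _ (one_sub_mem_wpF (hmem i hi1.le (by omega)) hpos.ne')
      exact ⟨j, fun _ _ => ⟨by omega, hj⟩⟩
    · exact ⟨0, fun h1 h2 => absurd ⟨h1, h2⟩ hi⟩
  choose g hg using hex
  have hanti : ∀ i, 1 ≤ i → i + 1 ≤ k + 1 → g (i + 1) < g i := by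
    intro i hi hik
    obtain ⟨hgi, hfi⟩ := hg i hi (by omega)
    obtain ⟨hgi', hfi'⟩ := hg (i + 1) (by omega) hik
    have hlt := hmono i (i + 1) hi (by omega) hik
    by_contra! hle
    rcases eq_or_lt_of_le hle with heq | hlt'
    · rw [heq, hfi'] at hfi
      linarith
    · have := hmono _ _ hgi.1 hlt' hgi'.2
      linarith
  have hrefl : ∀ i j, 1 ≤ i → i ≤ k + 1 → j + i = k + 2 → f j = 1 - f i := by
    intro i j hi hik hij
    have := add_eq_of_strictAnti_of_mem_Icc (fun i h h' => (hg i h h').1) hanti hi hik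
    obtain rfl : j = g i := by omega
    exact (hg i hi hik).2
  intro i j hi hik hj hjk hij
  have h1 := hrefl i (j + 1) hi (by omega) (by omega)
  have h2 := hrefl (i + 1) j (by omega) (by omega) (by omega)
  linarith
end

section
/- (Corollary to Proposition 4.2, symmetry and nondegeneracy of the pairing) The σ×σ matrix S of the pairing ⟨⟨P_α, P_β⟩⟩ is symmetric and invertible. -/
open Finset

lemma mem_wpS_iff (n : ℕ) (w : Fin (n + 1) → ℕ) (x : ℚ) (j : Fin (n + 1)) :
    j ∈ wpS n w x ↔ ∃ z : ℤ, (w j : ℚ) * x = (z : ℚ) := by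
  simp [wpS]

lemma wpS_one_sub (n : ℕ) (w : Fin (n + 1) → ℕ) (x : ℚ) : wpS n w (1 - x) = wpS n w x := by
  ext j
  simp only [mem_wpS_iff]
  constructor
  · rintro ⟨z, hz⟩
    exact ⟨w j - z, by push_cast; linarith⟩
  · rintro ⟨z, hz⟩
    exact ⟨w j - z, by push_cast; linarith⟩

lemma wpS_zero (n : ℕ) (w : Fin (n + 1) → ℕ) : wpS n w 0 = Finset.univ := by
  ext j
  simp only [mem_wpS_iff, Finset.mem_univ, iff_true]
  exact ⟨0, by simp⟩

lemma mem_wpF_iff (n : ℕ) (w : Fin (n + 1) → ℕ) (hw : ∀ j, 0 < w j) (x : ℚ) :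
    x ∈ wpF n w ↔ 0 ≤ x ∧ x < 1 ∧ ∃ j, j ∈ wpS n w x := by
  simp only [wpF, mem_wpS_iff, Finset.mem_image, Finset.mem_sigma, Finset.mem_univ, true_and,
    Finset.mem_range, Sigma.exists]
  constructor
  · rintro ⟨j, l, hl, rfl⟩
    have h : (0 : ℚ) < w j := by exact_mod_cast hw j
    refine ⟨by positivity, ?_, j, l, ?_⟩
    · rw [div_lt_one h]
      exact_mod_cast hl
    · push_cast
      field_simp
  · rintro ⟨h0, h1, j, z, hz⟩
    have h : (0 : ℚ) < w j := by exact_mod_cast hw j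
    have hz0 : 0 ≤ z := by
      have : (0 : ℚ) ≤ z := hz ▸ by positivity
      exact_mod_cast this
    lift z to ℕ using hz0
    refine ⟨j, z, ?_, ?_⟩
    · have : (z : ℚ) < w j := by
        push_cast at hz
        nlinarith
      exact_mod_cast this
    · push_cast at hz
      rw [← hz]
      field_simp

/-- For each weight `w j`, exactly `w j` elements `x` of `wpF` satisfy `w j * x ∈ ℤ`. -/
lemma card_filter_mem_wpS (n : ℕ) (w : Fin (n + 1) → ℕ) (hw : ∀ j, 0 < w j) (j : Fin (n + 1)) :
    ((wpF n w).filter fun x => j ∈ wpS n w x).card = w j := by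
  have h : (0 : ℚ) < w j := by exact_mod_cast hw j
  have himage : ((wpF n w).filter fun x => j ∈ wpS n w x) =
      (Finset.range (w j)).image fun l : ℕ => (l : ℚ) / (w j : ℚ) := by
    ext x
    rw [Finset.mem_filter, mem_wpF_iff n w hw, Finset.mem_image]
    constructor
    · rintro ⟨⟨h0, h1, -⟩, hj⟩
      obtain ⟨z, hz⟩ := (mem_wpS_iff n w x j).mp hj
      have hz0 : 0 ≤ z := by
        have : (0 : ℚ) ≤ z := hz ▸ by positivity
        exact_mod_cast this
      lift z to ℕ using hz0
      push_cast at hz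
      refine ⟨z, ?_, ?_⟩
      · rw [Finset.mem_range]
        have : (z : ℚ) < w j := by nlinarith
        exact_mod_cast this
      · rw [← hz]
        field_simp
    · rintro ⟨l, hl, rfl⟩
      have hj : j ∈ wpS n w ((l : ℚ) / w j) := by
        refine (mem_wpS_iff n w _ j).mpr ⟨l, ?_⟩
        push_cast
        field_simp
      refine ⟨⟨by positivity, ?_, j, hj⟩, hj⟩
      rw [div_lt_one h]
      exact_mod_cast Finset.mem_range.mp hl
  rw [himage, Finset.card_image_of_injective, Finset.card_range]
  intro a b hab
  have hab' : (a : ℚ) / w j = b / w j := hab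
  rw [div_left_inj' h.ne'] at hab'
  exact_mod_cast hab'

lemma sum_card_wpS (n : ℕ) (w : Fin (n + 1) → ℕ) (hw : ∀ j, 0 < w j) :
    ∑ x ∈ wpF n w, (wpS n w x).card = ∑ j, w j := by
  have h := Finset.sum_card_bipartiteAbove_eq_sum_card_bipartiteBelow
    (s := wpF n w) (t := Finset.univ) (fun x j => j ∈ wpS n w x)
  simp only [Finset.bipartiteAbove, Finset.bipartiteBelow, card_filter_mem_wpS n w hw] at h
  simpa using h

/-- Two strictly increasing enumerations of the same finite set agree. -/
lemma eq_of_strictMono_of_same_image {α : Type*} [LinearOrder α] {N : ℕ} {f g : ℕ → α}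
    (hf : ∀ i j : ℕ, 1 ≤ i → i < j → j ≤ N → f i < f j)
    (hg : ∀ i j : ℕ, 1 ≤ i → i < j → j ≤ N → g i < g j)
    (hfg : ∀ i, 1 ≤ i → i ≤ N → ∃ j, 1 ≤ j ∧ j ≤ N ∧ g j = f i)
    (hgf : ∀ i, 1 ≤ i → i ≤ N → ∃ j, 1 ≤ j ∧ j ≤ N ∧ f j = g i)
    (i : ℕ) (hi : 1 ≤ i) (hiN : i ≤ N) : f i = g i := by
  induction i using Nat.strong_induction_on with
  | _ i ih =>
    apply le_antisymm
    · obtain ⟨j, hj, hjN, h⟩ := hgf i hi hiN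
      rw [← h]
      rcases lt_trichotomy i j with hij | rfl | hij
      · exact (hf i j hi hij hjN).le
      · exact le_rfl
      · exact absurd (h.symm.trans (ih j hij hj hjN)) (hg j i hj hij hiN).ne'
    · obtain ⟨j, hj, hjN, h⟩ := hfg i hi hiN
      rw [← h]
      rcases lt_trichotomy i j with hij | rfl | hij
      · exact (hg i j hi hij hjN).le
      · exact le_rfl
      · exact absurd (h.symm.trans (ih j hij hj hjN).symm) (hf j i hj hij hiN).ne'

/-- The enumeration of `wpF ∪ {1}` is symmetric under `x ↦ 1 - x`. -/
lemma enum_reflect {n k : ℕ} {w : Fin (n + 1) → ℕ} (hw : ∀ j, 0 < w j) {f : ℕ → ℚ}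
    (hmono : ∀ i j : ℕ, 1 ≤ i → i < j → j ≤ k + 1 → f i < f j)
    (hmem : ∀ i : ℕ, 1 ≤ i → i ≤ k → f i ∈ wpF n w)
    (hsurj : ∀ x ∈ wpF n w, ∃ i : ℕ, 1 ≤ i ∧ i ≤ k ∧ f i = x)
    (hf1 : f 1 = 0) (hfk1 : f (k + 1) = 1) (i : ℕ) (hi : 1 ≤ i) (hik : i ≤ k + 1) :
    f i = 1 - f (k + 2 - i) := by
  have hrefl : ∀ i, 1 ≤ i → i ≤ k + 1 → ∃ j, 1 ≤ j ∧ j ≤ k + 1 ∧ f j = 1 - f i := by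
    intro i hi hik
    rcases hik.eq_or_lt with rfl | hik
    · exact ⟨1, le_rfl, by omega, by rw [hf1, hfk1]; norm_num⟩
    rcases hi.eq_or_lt with rfl | hi'
    · exact ⟨k + 1, by omega, le_rfl, by rw [hf1, hfk1]; norm_num⟩
    · have h0 := hmono 1 i le_rfl hi' (by omega)
      obtain ⟨-, h1, j, hj⟩ := (mem_wpF_iff n w hw _).mp (hmem i hi (by omega))
      obtain ⟨l, hl, hlk, h⟩ := hsurj (1 - f i) ((mem_wpF_iff n w hw _).mpr
        ⟨by linarith, by linarith, j, by rwa [wpS_one_sub]⟩)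
      exact ⟨l, hl, by omega, h⟩
  refine eq_of_strictMono_of_same_image (N := k + 1) (g := fun i => 1 - f (k + 2 - i))
    hmono ?_ ?_ ?_ i hi hik
  · intro i j hi hij hj
    have := hmono (k + 2 - j) (k + 2 - i) (by omega) (by omega) (by omega)
    linarith
  · intro i hi hik
    obtain ⟨j, hj, hjk, h⟩ := hrefl i hi hik
    refine ⟨k + 2 - j, by omega, by omega, ?_⟩
    rw [show k + 2 - (k + 2 - j) = j by omega, h]
    ring
  · intro i hi hik
    exact hrefl (k + 2 - i) (by omega) (by omega)

lemma sum_Icc_card_wpS {n k : ℕ} {w : Fin (n + 1) → ℕ} (hw : ∀ j, 0 < w j) {f : ℕ → ℚ}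
    (hmono : ∀ i j : ℕ, 1 ≤ i → i < j → j ≤ k + 1 → f i < f j)
    (hmem : ∀ i : ℕ, 1 ≤ i → i ≤ k → f i ∈ wpF n w)
    (hsurj : ∀ x ∈ wpF n w, ∃ i : ℕ, 1 ≤ i ∧ i ≤ k ∧ f i = x) :
    ∑ l ∈ Finset.Icc 1 k, (wpS n w (f l)).card = ∑ j, w j := by
  rw [← sum_card_wpS n w hw]
  refine Finset.sum_bij (fun i _ => f i) ?_ ?_ ?_ (fun _ _ => rfl)
  · intro i hi
    rw [Finset.mem_Icc] at hi
    exact hmem i hi.1 hi.2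
  · intro i hi j hj hij
    rw [Finset.mem_Icc] at hi hj
    rcases lt_trichotomy i j with h | h | h
    · exact absurd hij (hmono i j hi.1 h (by omega)).ne
    · exact h
    · exact absurd hij (hmono j i hj.1 h (by omega)).ne'
  · intro x hx
    obtain ⟨i, hi, hik, h⟩ := hsurj x hx
    exact ⟨i, Finset.mem_Icc.mpr ⟨hi, hik⟩, h⟩

/-- Partial sums of a sequence `u 1, …, u k` with `u j = u (k + 2 - j)` for `2 ≤ j ≤ k`. -/
lemma sum_Icc_add_sum_Icc_reflect {k : ℕ} {u : ℕ → ℕ}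
    (hu : ∀ j, 2 ≤ j → j ≤ k → u (k + 2 - j) = u j) (i : ℕ) (hi : 1 ≤ i) (hik : i ≤ k) :
    ∑ l ∈ Finset.Icc 1 i, u l + ∑ l ∈ Finset.Icc 1 (k + 1 - i), u l =
      ∑ l ∈ Finset.Icc 1 k, u l + u 1 := by
  induction i, hi using Nat.le_induction with
  | base => simp [add_comm]
  | succ i hi ih =>
    have ih := ih (by omega)
    have h := hu (i + 1) (by omega) hik
    rw [show k + 1 - i = (k + 1 - (i + 1)) + 1 by omega,
      Finset.sum_Icc_succ_top (by omega)] at ih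
    rw [show k + 2 - (i + 1) = k + 1 - (i + 1) + 1 by omega] at h
    rw [Finset.sum_Icc_succ_top (by omega)]
    omega

lemma exists_le_lt_succ {U : ℕ → ℕ} {k a : ℕ} (hk : 1 ≤ k) (h1 : U 1 ≤ a) (hU : a < U k) :
    ∃ i, 1 ≤ i ∧ i ≤ k - 1 ∧ U i ≤ a ∧ a < U (i + 1) := by
  induction k, hk using Nat.le_induction with
  | base => omega
  | succ k hk ih =>
    by_cases h : a < U k
    · obtain ⟨i, h1, h2, h3⟩ := ih h
      exact ⟨i, h1, by omega, h3⟩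
    · exact ⟨k, hk, by omega, by omega, hU⟩

/-- A matrix supported on the graph of a permutation, with nonzero entries there, is invertible. -/
lemma isUnit_of_support_perm {ι K : Type*} [Fintype ι] [DecidableEq ι] [Field K]
    (A : Matrix ι ι K) (e : Equiv.Perm ι) (hne : ∀ a, A a (e a) ≠ 0)
    (hzero : ∀ a b, b ≠ e a → A a b = 0) : IsUnit A := by
  have h : A.submatrix (Equiv.refl ι) e = Matrix.diagonal fun a => A a (e a) := by
    ext a b
    by_cases hab : a = b
    · subst hab
      simp
    · rw [Matrix.diagonal_apply_ne _ hab, Matrix.submatrix_apply]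
      exact hzero a (e b) fun h => hab (e.injective h).symm
  rw [← Matrix.isUnit_submatrix_equiv (Equiv.refl ι) e, h, Matrix.isUnit_diagonal, Pi.isUnit_iff]
  exact fun a => (hne a).isUnit

theorem pairing_symm_nondeg (n k : ℕ) (w : Fin (n + 1) → ℕ) (hw : ∀ j, 0 < w j)
    (f : ℕ → ℚ)
    (hmono : ∀ i j : ℕ, 1 ≤ i → i < j → j ≤ k + 1 → f i < f j)
    (hmem : ∀ i : ℕ, 1 ≤ i → i ≤ k → f i ∈ wpF n w)
    (hsurj : ∀ x ∈ wpF n w, ∃ i : ℕ, 1 ≤ i ∧ i ≤ k ∧ f i = x)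
    (hf1 : f 1 = 0) (hfk1 : f (k + 1) = 1)
    (S : Matrix (Fin (∑ j, w j)) (Fin (∑ j, w j)) ℝ)
    (hS_top : ∀ α β : Fin (∑ j, w j), (α : ℕ) + (β : ℕ) = n →
      S α β = 1 / ∏ l ∈ wpS n w (f 1), (w l : ℝ))
    (hS_block : ∀ α β : Fin (∑ j, w j), ∀ i : ℕ, 1 ≤ i → i ≤ k - 1 →
      (α : ℕ) + (β : ℕ) = (∑ j, w j) + n →
      (∑ l ∈ Finset.Icc 1 i, (wpS n w (f l)).card) ≤ (α : ℕ) →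
      (α : ℕ) ≤ (∑ l ∈ Finset.Icc 1 (i + 1), (wpS n w (f l)).card) - 1 →
      S α β = 1 / ∏ l ∈ wpS n w (f (i + 1)), (w l : ℝ))
    (hS_zero : ∀ α β : Fin (∑ j, w j), (α : ℕ) + (β : ℕ) ≠ n →
      ¬((α : ℕ) + (β : ℕ) = (∑ j, w j) + n ∧ ∃ i : ℕ, 1 ≤ i ∧ i ≤ k - 1 ∧
        (∑ l ∈ Finset.Icc 1 i, (wpS n w (f l)).card) ≤ (α : ℕ) ∧
        (α : ℕ) ≤ (∑ l ∈ Finset.Icc 1 (i + 1), (wpS n w (f l)).card) - 1) →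
      S α β = 0) :
    S.IsSymm ∧ IsUnit S := by
  have hUk := sum_Icc_card_wpS hw hmono hmem hsurj
  generalize ∑ j, w j = σ at *
  set U : ℕ → ℕ := fun i => ∑ l ∈ Finset.Icc 1 i, (wpS n w (f l)).card with hU
  have hk : 1 ≤ k := by
    obtain ⟨i, hi, hik, -⟩ := hsurj 0 ((mem_wpF_iff n w hw 0).mpr
      ⟨le_rfl, one_pos, 0, by simp [wpS_zero]⟩)
    omega
  replace hUk : U k = σ := hUk
  have hu1 : (wpS n w (f 1)).card = n + 1 := by simp [hf1, wpS_zero]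
  have hU1 : U 1 = n + 1 := by simp [hU, hu1]
  have hUmono : Monotone U := fun a b hab =>
    Finset.sum_le_sum_of_subset (Finset.Icc_subset_Icc_right hab)
  have hσn : n + 1 ≤ σ := hU1 ▸ hUk ▸ hUmono hk
  have hwpS : ∀ j, 1 ≤ j → j ≤ k + 1 → wpS n w (f (k + 2 - j)) = wpS n w (f j) := by
    intro j hj hjk
    rw [enum_reflect hw hmono hmem hsurj hf1 hfk1 j hj hjk, wpS_one_sub]
  have hUrefl : ∀ i, 1 ≤ i → i ≤ k → U i + U (k + 1 - i) = σ + (n + 1) := by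
    intro i hi hik
    rw [← hUk, ← hu1]
    exact sum_Icc_add_sum_Icc_reflect
      (fun j hj hjk => by rw [hwpS j (by omega) (by omega)]) i hi hik
  have hindex : ∀ α β : Fin σ, (α : ℕ) + β = σ + n →
      ∃ i, 1 ≤ i ∧ i ≤ k - 1 ∧ U i ≤ α ∧ (α : ℕ) < U (i + 1) := by
    intro α β h
    exact exists_le_lt_succ hk (by have := β.isLt; omega) (by have := α.isLt; omega)
  have hprod : ∀ x, 1 / ∏ l ∈ wpS n w x, (w l : ℝ) ≠ 0 := by
    intro x
    refine one_div_ne_zero (Finset.prod_ne_zero_iff.mpr fun l _ => ?_)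
    exact_mod_cast (hw l).ne'
  have hzero : ∀ α β : Fin σ, (α : ℕ) + β ≠ n → (α : ℕ) + β ≠ σ + n → S α β = 0 :=
    fun α β h1 h2 => hS_zero α β h1 fun h => h2 h.1
  have hblock : ∀ α β : Fin σ, ∀ i, 1 ≤ i → i ≤ k - 1 → (α : ℕ) + β = σ + n → U i ≤ α →
      (α : ℕ) < U (i + 1) → S α β = 1 / ∏ l ∈ wpS n w (f (i + 1)), (w l : ℝ) :=
    fun α β i hi hik h h1 h2 => hS_block α β i hi hik h h1 (Nat.le_sub_one_of_lt h2)
  constructor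
  · ext α β
    rw [Matrix.transpose_apply]
    by_cases h1 : (α : ℕ) + β = n
    · rw [hS_top α β h1, hS_top β α (by omega)]
    by_cases h2 : (α : ℕ) + β = σ + n
    · obtain ⟨i, hi, hik, hl, hr⟩ := hindex α β h2
      have e1 := hUrefl i hi (by omega)
      have e2 := hUrefl (i + 1) (by omega) (by omega)
      rw [show k + 1 - (i + 1) = k - i by omega] at e2
      rw [show k + 1 - i = k - i + 1 by omega] at e1
      rw [hblock α β i hi hik h2 hl hr,
        hblock β α (k - i) (by omega) (by omega) (by omega) (by omega) (by omega),
        ← hwpS (i + 1) (by omega) (by omega), show k + 2 - (i + 1) = k - i + 1 by omega]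
    · rw [hzero α β h1 h2, hzero β α (by omega) (by omega)]
  · let p : Fin σ → Fin σ := fun α =>
      ⟨if (α : ℕ) ≤ n then n - α else σ + n - α, by have := α.isLt; split_ifs <;> omega⟩
    have hp : Function.Involutive p := by
      intro α
      have := α.isLt
      ext
      simp only [p]
      split_ifs <;> omega
    have hpval : ∀ α : Fin σ, (p α : ℕ) = if (α : ℕ) ≤ n then n - α else σ + n - α :=
      fun _ => rfl
    refine isUnit_of_support_perm S (hp.toPerm p) (fun α => ?_) (fun α β hβ => ?_)
    · change S α (p α) ≠ 0
      have hα := α.isLt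
      have hv := hpval α
      split_ifs at hv with h
      · rw [hS_top α (p α) (by omega)]
        exact hprod _
      · have hsum : (α : ℕ) + p α = σ + n := by omega
        obtain ⟨i, hi, hik, hl, hr⟩ := hindex α _ hsum
        rw [hblock α _ i hi hik hsum hl hr]
        exact hprod _
    · have hα := α.isLt
      have hβ' := β.isLt
      have hv := hpval α
      have hne : (β : ℕ) ≠ p α := fun h => hβ (Fin.ext h)
      split_ifs at hv with h
      · exact hzero α β (by omega) (by omega)
      · exact hzero α β (by omega) (by omega)
end
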